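/- arXiv:1703.09804 — 2 statements merged into one kernel-verified Lean document; each statement's English description precedes it below -/
import Mathlib

section
/- Let n ≥ 1 and let μ₁, …, μₙ be non-atomic probability measures on the interval [0,1]. Then for every permutation σ of {1, …, n} there exists a partition of [0,1] into n consecutive intervals, determined by cut points 0 = x₀ ≤ x₁ ≤ ⋯ ≤ xₙ = 1, such that μ_{σ(1)}([x₀, x₁]) = μ_{σ(2)}([x₁, x₂]) = ⋯ = μ_{σ(n)}([x_{n-1}, xₙ]). -/
open Set Filter Topology MeasureTheory ProbabilityTheory

/-- If consecutive cells of a partition of `[0, t]` take a common value `v s` on `[0, s]`, then a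
further cell `[s t, t]`, measured by `F`, can be appended so that it takes the same value. -/
theorem exists_balanced_cut {v F : ℝ → ℝ} (hv0 : v 0 = 0) (hvm : MonotoneOn v (Ici 0))
    (hvc : ContinuousOn v (Ici 0)) (hFm : Monotone F) (hFc : Continuous F) :
    ∃ s : ℝ → ℝ, (∀ t, 0 ≤ t → 0 ≤ s t ∧ s t ≤ t ∧ F t - F (s t) = v (s t)) ∧
      v (s 0) = 0 ∧ MonotoneOn (fun t => v (s t)) (Ici 0) ∧
      ContinuousOn (fun t => v (s t)) (Ici 0) := by
  have hcut : ∀ t : ℝ, ∃ s, 0 ≤ t → 0 ≤ s ∧ s ≤ t ∧ F t - F s = v s := by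
    intro t
    by_cases ht : 0 ≤ t
    · have hc : ContinuousOn (fun s => v s + F s) (Icc 0 t) :=
        (hvc.mono Icc_subset_Ici_self).add hFc.continuousOn
      have hv_nonneg : v 0 ≤ v t := hvm self_mem_Ici ht ht
      obtain ⟨s, hs, hst⟩ := intermediate_value_Icc ht hc
        (show F t ∈ Icc (v 0 + F 0) (v t + F t) from
          ⟨by have := hFm ht; linarith, by linarith⟩)
      exact ⟨s, fun _ => ⟨hs.1, hs.2, by simp only at hst; linarith⟩⟩
    · exact ⟨0, fun h => absurd h ht⟩
  choose s hs using hcut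
  have key : ∀ t t', 0 ≤ t → t ≤ t' →
      v (s t) ≤ v (s t') ∧ v (s t') - v (s t) ≤ F t' - F t := by
    intro t t' ht htt
    obtain ⟨h1, _, h3⟩ := hs t ht
    obtain ⟨h1', _, h3'⟩ := hs t' (ht.trans htt)
    have hF := hFm htt
    rcases le_total (s t) (s t') with h | h
    · have h4 := hvm h1 h1' h
      have h5 := hFm h
      constructor <;> linarith
    · have h4 := hvm h1' h1 h
      have h5 := hFm h
      constructor <;> linarith
  refine ⟨s, hs, ?_, fun t ht t' _ htt => (key t t' ht htt).1, ?_⟩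
  · obtain ⟨h1, h2, _⟩ := hs 0 le_rfl
    rw [le_antisymm h2 h1, hv0]
  · rw [Metric.continuousOn_iff]
    intro t ht ε hε
    obtain ⟨δ, hδ, h⟩ := Metric.continuous_iff.1 hFc t ε hε
    refine ⟨δ, hδ, fun t' ht' hd => lt_of_le_of_lt ?_ (h t' hd)⟩
    rw [Real.dist_eq, Real.dist_eq]
    rcases le_total t t' with htt | htt
    · obtain ⟨h1, h2⟩ := key t t' ht htt
      rw [abs_of_nonneg (sub_nonneg.2 h1)]
      exact h2.trans (le_abs_self _)
    · obtain ⟨h1, h2⟩ := key t' t ht' htt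
      rw [abs_sub_comm, abs_of_nonneg (sub_nonneg.2 h1), abs_sub_comm]
      exact h2.trans (le_abs_self _)

/-- For continuous monotone functions `F i`, every interval `[0, t]` admits a partition into
`k + 1` consecutive intervals with equal increments of `F 0, …, F k`; the common increment depends
continuously and monotonically on `t`. -/
theorem exists_equal_increments {F : ℕ → ℝ → ℝ} (hFm : ∀ i, Monotone (F i))
    (hFc : ∀ i, Continuous (F i)) (k : ℕ) :
    ∃ v : ℝ → ℝ, v 0 = 0 ∧ MonotoneOn v (Ici 0) ∧ ContinuousOn v (Ici 0) ∧
      ∀ t, 0 ≤ t → ∃ x : ℕ → ℝ, x 0 = 0 ∧ x (k + 1) = t ∧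
        ∀ i ≤ k, x i ≤ x (i + 1) ∧ F i (x (i + 1)) - F i (x i) = v t := by
  induction k with
  | zero =>
    refine ⟨fun t => F 0 t - F 0 0, sub_self _, fun a _ b _ h => sub_le_sub_right (hFm 0 h) _,
      ((hFc 0).sub continuous_const).continuousOn, fun t ht => ⟨fun i => if i = 0 then 0 else t,
      by simp, by simp, fun i hi => ?_⟩⟩
    obtain rfl : i = 0 := by omega
    simpa using ht
  | succ k ih =>
    obtain ⟨v, hv0, hvm, hvc, hx⟩ := ih
    obtain ⟨s, hs, hw0, hwm, hwc⟩ := exists_balanced_cut hv0 hvm hvc (hFm (k + 1)) (hFc (k + 1))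
    refine ⟨fun t => v (s t), hw0, hwm, hwc, fun t ht => ?_⟩
    obtain ⟨h1, h2, h3⟩ := hs t ht
    obtain ⟨x, hx0, hxk, hxi⟩ := hx (s t) h1
    refine ⟨fun i => if i ≤ k + 1 then x i else t, by simpa using hx0, by simp, fun i hi => ?_⟩
    rcases hi.lt_or_eq with hik | rfl
    · have hi' : i + 1 ≤ k + 1 := hik
      simp only [if_pos hi, if_pos hi']
      exact hxi i (by omega)
    · simpa [hxk] using ⟨h2, h3⟩

theorem continuous_cdf_of_nullSingletonClass (μ : Measure ℝ) [IsProbabilityMeasure μ] [NullSingletonClass μ] :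
    Continuous (cdf μ) := by
  rw [continuous_iff_continuousAt]
  intro a
  rw [(monotone_cdf μ).continuousAt_iff_leftLim_eq_rightLim, StieltjesFunction.rightLim_eq]
  refine le_antisymm ((monotone_cdf μ).leftLim_le le_rfl) ?_
  have h := (cdf μ).measure_singleton a
  rw [measure_cdf, measure_singleton] at h
  linarith [ENNReal.ofReal_eq_zero.1 h.symm]

theorem measure_Icc_eq_ofReal_cdf_sub (μ : Measure ℝ) [IsProbabilityMeasure μ] [NullSingletonClass μ]
    (a b : ℝ) : μ (Icc a b) = ENNReal.ofReal (cdf μ b - cdf μ a) := by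
  rw [← Ioc_ae_eq_Icc.measure_eq, ← (cdf μ).measure_Ioc, measure_cdf]

/-- **Equitable simple division for non-atomic probability measures.**
Given `n ≥ 1` non-atomic probability measures `μ i` on `[0,1]` and a
permutation `σ` prescribing the players' order, there exist cut points
`0 = x₀ ≤ x₁ ≤ ⋯ ≤ xₙ = 1` such that all values `μ_{σ(i)}([x_{i-1}, x_i])`
coincide. -/
theorem equitable_simple_division_measures
    (n : ℕ) (hn : 1 ≤ n) (μ : Fin n → MeasureTheory.Measure ℝ)
    (hprob : ∀ i, MeasureTheory.IsProbabilityMeasure (μ i))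
    (hatom : ∀ i, MeasureTheory.NoAtoms (μ i))
    (hsupp : ∀ i, μ i (Set.Icc (0:ℝ) 1) = 1)
    (σ : Equiv.Perm (Fin n)) :
    ∃ x : Fin (n + 1) → ℝ,
      x 0 = 0 ∧ x (Fin.last n) = 1 ∧ Monotone x ∧
      ∀ i j : Fin n,
        μ (σ i) (Set.Icc (x i.castSucc) (x i.succ)) =
        μ (σ j) (Set.Icc (x j.castSucc) (x j.succ)) := by
  have hnull : ∀ i, NullSingletonClass (μ i) := hatom
  obtain ⟨m, rfl⟩ : ∃ m, n = m + 1 := ⟨n - 1, by omega⟩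
  obtain ⟨v, -, -, -, hx⟩ := exists_equal_increments
    (F := fun i => cdf (μ (σ (Fin.ofNat (m + 1) i)))) (fun i => monotone_cdf _)
    (fun i => continuous_cdf_of_nullSingletonClass _) m
  obtain ⟨x, hx0, hx1, hxi⟩ := hx 1 zero_le_one
  have hvalue : ∀ i : Fin (m + 1),
      μ (σ i) (Icc (x i.castSucc) (x i.succ)) = ENNReal.ofReal (v 1) := by
    intro i
    have h := (hxi i (Nat.lt_succ_iff.1 i.2)).2
    rw [measure_Icc_eq_ofReal_cdf_sub, ← h]
    simp
  refine ⟨fun i => x i, hx0, hx1, Fin.monotone_iff_le_succ.2 fun i => ?_, fun i j => ?_⟩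
  · simpa using (hxi i (Nat.lt_succ_iff.1 i.2)).1
  · rw [hvalue i, hvalue j]
end

section
/- Let n ≥ 1, let f₁, …, fₙ : [0,1] → ℝ be nonnegative integrable functions with ∫₀¹ fᵢ = 1, and let σ be a permutation of {1, …, n}. Define, for e = (e₁, …, eₙ) in the unit sphere S^{n-1} ⊂ ℝⁿ and for 1 ≤ i ≤ n-1, Fᵢ(e) = sgn(e_{i+1}) · ∫_{e₁²+⋯+eᵢ²}^{e₁²+⋯+eᵢ²+e_{i+1}²} f_{σ(i+1)}(x) dx − sgn(e₁) · ∫₀^{e₁²} f_{σ(1)}(x) dx. Then there exists a point ẽ ∈ S^{n-1} such that Fᵢ(ẽ) = 0 for every i ∈ {1, …, n-1}. -/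
/-- A function on `[0, ∞)` whose increments are nonnegative and dominated by those of a continuous
function is continuous. -/
theorem continuousOn_Ici_of_increments_le {G Q : ℝ → ℝ} {a : ℝ} (hQ : Continuous Q)
    (hG : MonotoneOn G (Set.Ici a))
    (hGQ : ∀ s t, a ≤ s → s ≤ t → G t - G s ≤ Q t - Q s) : ContinuousOn G (Set.Ici a) := by
  rw [Metric.continuousOn_iff]
  intro b hb ε hε
  obtain ⟨δ, hδ, h⟩ := Metric.continuous_iff.mp hQ b ε hε
  refine ⟨δ, hδ, fun x hx hxb => lt_of_le_of_lt ?_ (h x hxb)⟩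
  rw [Real.dist_eq, Real.dist_eq]
  rcases le_total x b with hle | hle
  · rw [abs_sub_comm, abs_of_nonneg (sub_nonneg.mpr (hG hx hb hle)), abs_sub_comm]
    exact (hGQ x b hx hle).trans (le_abs_self _)
  · rw [abs_of_nonneg (sub_nonneg.mpr (hG hb hx hle))]
    exact (hGQ b x hb hle).trans (le_abs_self _)

/-- Given continuous monotone functions `P 0, …, P k`, every interval `[0, t]` can be cut into
`k + 1` consecutive intervals such that the increment of `P i` over the `i`-th one is independent
of `i`; this common value `G t` is moreover monotone and continuous in `t`. -/
theorem exists_equal_increments_s2 (P : ℕ → ℝ → ℝ) (hc : ∀ i, Continuous (P i))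
    (hm : ∀ i, Monotone (P i)) (k : ℕ) :
    ∃ G : ℝ → ℝ, G 0 = 0 ∧ MonotoneOn G (Set.Ici 0) ∧
      (∀ s t, 0 ≤ s → s ≤ t → G t - G s ≤ P k t - P k s) ∧
      ∀ t, 0 ≤ t → ∃ c : ℕ → ℝ, c 0 = 0 ∧ c (k + 1) = t ∧
        ∀ i ≤ k, c i ≤ c (i + 1) ∧ P i (c (i + 1)) - P i (c i) = G t := by
  induction k with
  | zero =>
    refine ⟨fun t => P 0 t - P 0 0, by simp, fun s _ t _ h => by simpa using hm 0 h,
      fun s t _ _ => by simp, fun t ht => ⟨fun i => if i = 0 then 0 else t, by simp, by simp, ?_⟩⟩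
    intro i hi
    obtain rfl : i = 0 := by omega
    simp [ht]
  | succ k ih =>
    obtain ⟨G, hG0, hGm, hGP, hG⟩ := ih
    have hGc := continuousOn_Ici_of_increments_le (hc k) hGm hGP
    have key : ∀ t, ∃ s, 0 ≤ t → 0 ≤ s ∧ s ≤ t ∧ G s = P (k + 1) t - P (k + 1) s := by
      intro t
      by_cases ht : 0 ≤ t
      · have hcont : ContinuousOn (fun s => G s - (P (k + 1) t - P (k + 1) s)) (Set.Icc 0 t) :=
          (hGc.mono Set.Icc_subset_Ici_self).sub
            (continuous_const.sub (hc (k + 1))).continuousOn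
        have h0 : G 0 - (P (k + 1) t - P (k + 1) 0) ≤ 0 := by
          have := hm (k + 1) ht
          linarith
        have h1 : 0 ≤ G t - (P (k + 1) t - P (k + 1) t) := by
          have := hGm (Set.mem_Ici.mpr le_rfl) ht ht
          linarith
        obtain ⟨s, hs, hs'⟩ := intermediate_value_Icc ht hcont ⟨h0, h1⟩
        exact ⟨s, fun _ => ⟨hs.1, hs.2, sub_eq_zero.mp hs'⟩⟩
      · exact ⟨0, fun h => absurd h ht⟩
    choose S hS using key
    refine ⟨fun t => G (S t), ?_, ?_, ?_, ?_⟩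
    · obtain ⟨h1, h2, -⟩ := hS 0 le_rfl
      simp only [le_antisymm h2 h1, hG0]
    · intro s hs t ht hst
      obtain ⟨hs1, hs2, hs3⟩ := hS s hs
      obtain ⟨ht1, ht2, ht3⟩ := hS t ht
      rcases le_total (S s) (S t) with h | h
      · exact hGm hs1 ht1 h
      · have h1 := hm (k + 1) h
        have h2 := hm (k + 1) hst
        change G (S s) ≤ G (S t)
        linarith
    · intro s t hs hst
      obtain ⟨hs1, hs2, hs3⟩ := hS s hs
      obtain ⟨ht1, ht2, ht3⟩ := hS t (hs.trans hst)
      rcases le_total (S s) (S t) with h | h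
      · have h1 := hm (k + 1) h
        change G (S t) - G (S s) ≤ _
        linarith
      · have h1 := hGm ht1 hs1 h
        have h2 := hm (k + 1) hst
        change G (S t) - G (S s) ≤ _
        linarith
    · intro t ht
      obtain ⟨h1, h2, h3⟩ := hS t ht
      obtain ⟨c, hc0, hck, hci⟩ := hG (S t) h1
      refine ⟨fun i => if i ≤ k + 1 then c i else t, by simp [hc0], by simp, fun i hi => ?_⟩
      rcases Nat.lt_or_ge k i with h | h
      · obtain rfl : i = k + 1 := by omega
        simp [hck, h2, h3]
      · simpa [show i ≤ k + 1 by omega, h] using hci i h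

/-- Nonnegative integrable functions `g 0, …, g (n - 1)` on `[0, 1]` admit an equitable division:
`[0, 1]` can be cut into consecutive intervals such that the integral of `g i` over the `i`-th one
is independent of `i`. -/
theorem exists_equitable_division {n : ℕ} (hn : 1 ≤ n) (g : Fin n → ℝ → ℝ)
    (hint : ∀ i, MeasureTheory.IntegrableOn (g i) (Set.Icc (0:ℝ) 1))
    (hnonneg : ∀ i, ∀ x ∈ Set.Icc (0:ℝ) 1, 0 ≤ g i x) :
    ∃ (c : ℕ → ℝ) (v : ℝ), c 0 = 0 ∧ c n = 1 ∧
      ∀ i : Fin n, c i ≤ c (i + 1) ∧ ∫ x in c i..c (i + 1), g i x = v := by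
  classical
  let q : ℕ → ℝ → ℝ := fun i =>
    if h : i < n then (Set.Icc (0:ℝ) 1).indicator (g ⟨i, h⟩) else 0
  have hqint : ∀ i, MeasureTheory.Integrable (q i) := by
    intro i
    by_cases h : i < n
    · simpa [q, h] using (hint ⟨i, h⟩).integrable_indicator measurableSet_Icc
    · simp only [q, h, dite_false]
      exact MeasureTheory.integrable_zero _ _ _
  have hq0 : ∀ i x, 0 ≤ q i x := by
    intro i x
    by_cases h : i < n
    · simpa [q, h] using Set.indicator_nonneg (hnonneg ⟨i, h⟩) x
    · simp [q, h]
  have hsub : ∀ i a b, (∫ x in (0:ℝ)..b, q i x) - ∫ x in (0:ℝ)..a, q i x = ∫ x in a..b, q i x :=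
    fun i a b => intervalIntegral.integral_interval_sub_left (hqint i).intervalIntegrable
      (hqint i).intervalIntegrable
  obtain ⟨G, -, -, -, hG⟩ := exists_equal_increments_s2 (fun i t => ∫ x in (0:ℝ)..t, q i x)
    (fun i => intervalIntegral.continuous_primitive
      (fun _ _ => (hqint i).intervalIntegrable) 0)
    (fun i a b hab => by
      rw [← sub_nonneg, hsub]
      exact intervalIntegral.integral_nonneg hab fun x _ => hq0 i x) (n - 1)
  obtain ⟨c, hc0, hcn, hc⟩ := hG 1 zero_le_one
  rw [Nat.sub_add_cancel hn] at hcn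
  have hmono : ∀ i j, i ≤ j → j ≤ n → c i ≤ c j := by
    intro i j hij
    induction j, hij using Nat.le_induction with
    | base => exact fun _ => le_rfl
    | succ j _ ih => exact fun hj => (ih (by omega)).trans (hc j (by omega)).1
  refine ⟨c, G 1, hc0, hcn, fun i => ?_⟩
  obtain ⟨hle, heq⟩ := hc i (by omega)
  refine ⟨hle, ?_⟩
  rw [← heq, hsub]
  refine intervalIntegral.integral_congr fun x hx => ?_
  rw [Set.uIcc_of_le hle] at hx
  have hx' : x ∈ Set.Icc (0:ℝ) 1 :=
    ⟨by linarith [hmono 0 i (by omega) (by omega), hx.1],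
      by linarith [hmono (i + 1) n (by omega) le_rfl, hx.2]⟩
  simp [q, Set.indicator_of_mem hx']

/-- A sum over the elements of `Fin n` below `k` is a sum over `Finset.range k`. -/
theorem Fin.sum_filter_lt_eq_sum_range {n : ℕ} (k : Fin n) (h : ℕ → ℝ) :
    ∑ j ∈ Finset.univ.filter (· < k), h j = ∑ i ∈ Finset.range k, h i := by
  refine Finset.sum_bij (fun j _ => (j : ℕ))
    (fun j hj => Finset.mem_range.mpr (Finset.mem_filter.mp hj).2)
    (fun _ _ _ _ hij => Fin.ext hij) (fun i hi => ?_) (fun _ _ => rfl)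
  have hik : i < k := Finset.mem_range.mp hi
  exact ⟨⟨i, hik.trans k.isLt⟩, Finset.mem_filter.mpr ⟨Finset.mem_univ _, hik⟩, rfl⟩

/-- If `d ≥ 0`, the sign of `√d` can be dropped in front of an integral over an interval of
length `d`. -/
theorem Real.sign_sqrt_mul_integral {a b : ℝ} (hab : a ≤ b) (g : ℝ → ℝ) :
    Real.sign √(b - a) * (∫ x in a..b, g x) = ∫ x in a..b, g x := by
  rcases hab.eq_or_lt with rfl | h
  · simp
  · rw [Real.sign_of_pos (Real.sqrt_pos.mpr (sub_pos.mpr h)), one_mul]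


open Finset in
/-- **Key intermediate step (Borsuk–Ulam zero).**
With densities `f i` on `[0,1]` and a permutation `σ`, there is a point
`e = (e₁, …, eₙ)` on the unit sphere `S^{n-1}` (i.e. `∑ eᵢ² = 1`) at which all
the maps
`Fᵢ(e) = sgn(e_{i+1}) ∫_{e₁²+⋯+eᵢ²}^{e₁²+⋯+eᵢ²+e_{i+1}²} f_{σ(i+1)}
        − sgn(e₁) ∫₀^{e₁²} f_{σ(1)}`, `1 ≤ i ≤ n-1`,
vanish.  (Indices are 0-based: `k ≠ 0` plays the role of `i+1`.) -/
theorem exists_sphere_point_all_F_vanish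
    (n : ℕ) (hn : 1 ≤ n) (f : Fin n → ℝ → ℝ)
    (hint : ∀ i, MeasureTheory.IntegrableOn (f i) (Set.Icc (0:ℝ) 1))
    (hnonneg : ∀ i, ∀ x ∈ Set.Icc (0:ℝ) 1, 0 ≤ f i x)
    (hone : ∀ i, (∫ x in (0:ℝ)..1, f i x) = 1)
    (σ : Equiv.Perm (Fin n)) :
    ∃ e : Fin n → ℝ, (∑ i, (e i) ^ 2) = 1 ∧
      ∀ k : Fin n, k ≠ ⟨0, hn⟩ →
        Real.sign (e k) *
          (∫ t in (∑ j ∈ univ.filter (· < k), (e j) ^ 2)..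
                  ((∑ j ∈ univ.filter (· < k), (e j) ^ 2) + (e k) ^ 2),
              f (σ k) t)
        - Real.sign (e ⟨0, hn⟩) *
            (∫ t in (0:ℝ)..((e ⟨0, hn⟩) ^ 2), f (σ ⟨0, hn⟩) t) = 0 := by
  obtain ⟨c, v, hc0, hcn, hc⟩ := exists_equitable_division hn (fun i => f (σ i))
    (fun i => hint (σ i)) (fun i => hnonneg (σ i))
  have hsq : ∀ i : Fin n, √(c (i + 1) - c i) ^ 2 = c (i + 1) - c i :=
    fun i => Real.sq_sqrt (sub_nonneg.mpr (hc i).1)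
  have hsum : ∀ k : Fin n, ∑ j ∈ univ.filter (· < k), (c (j + 1) - c j) = c k := by
    intro k
    rw [Fin.sum_filter_lt_eq_sum_range k fun i => c (i + 1) - c i, Finset.sum_range_sub, hc0, sub_zero]
  have hval : ∀ k : Fin n,
      Real.sign √(c (k + 1) - c k) * (∫ x in c k..c (k + 1), f (σ k) x) = v :=
    fun k => by rw [Real.sign_sqrt_mul_integral (hc k).1, (hc k).2]
  refine ⟨fun i => √(c (i + 1) - c i), ?_, fun k _ => ?_⟩
  · rw [Finset.sum_congr rfl fun j _ => hsq j, Fin.sum_univ_eq_sum_range fun i => c (i + 1) - c i,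
      Finset.sum_range_sub, hc0, hcn, sub_zero]
  · have hfirst := hval ⟨0, hn⟩
    rw [hc0, sub_zero] at hfirst
    have hsq0 := hsq ⟨0, hn⟩
    rw [hc0, sub_zero] at hsq0
    simp only [hsq, hsum, add_sub_cancel, hval, hc0, sub_zero, hsq0, hfirst, sub_self]
end
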